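/- arXiv:2412.18297 — 2 statements merged into one kernel-verified Lean document; each statement's English description precedes it below -/
import Mathlib

section
/- Suppose y* ∈ Δ_n is such that x⊗y* ∉ C(Φ) for every x ∈ Δ_m. Then there exists h ∈ ℝ^k with h_i ≥ 0 for all i such that for every CSP assignment Φ' = (φ'_1,…,φ'_k) ∈ (Δ_{mn})^k for which C(Φ') is response-satisfiable, one has Σ_{i∈[k]} h_i u_{O,i}(φ'_i) > Σ_{i∈[k]} h_i u_{O,i}(φ_i). In other words, the hyperplane Σ_i h_i u_{O,i}(φ'_i) ≤ Σ_i h_i u_{O,i}(φ_i) separates Φ from the valid candidate set S = {Φ' : C(Φ') is response-satisfiable}. -/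
open scoped BigOperators

noncomputable section

/-- Linear extension of a payoff function to CSPs. -/
def lin {m n : ℕ} (u : Fin m × Fin n → ℝ) (φ : Fin m × Fin n → ℝ) : ℝ :=
  ∑ p : Fin m × Fin n, φ p * u p

/-- The product distribution `x ⊗ y`. -/
def prodCSP {m n : ℕ} (x : Fin m → ℝ) (y : Fin n → ℝ) : Fin m × Fin n → ℝ :=
  fun p => x p.1 * y p.2

/-- A set of CSPs is response-satisfiable. -/
def ResponseSatisfiable {m n : ℕ} (M : Set (Fin m × Fin n → ℝ)) : Prop :=
  ∀ y ∈ stdSimplex ℝ (Fin n), ∃ x ∈ stdSimplex ℝ (Fin m), prodCSP x y ∈ M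

/-- The candidate menu `C(Φ)` of a CSP assignment `Φ`. -/
def candidateMenu {m n k : ℕ} (uO : Fin k → Fin m × Fin n → ℝ)
    (Φ : Fin k → Fin m × Fin n → ℝ) : Set (Fin m × Fin n → ℝ) :=
  {φ ∈ stdSimplex ℝ (Fin m × Fin n) | ∀ i, lin (uO i) φ ≤ lin (uO i) (Φ i)}

/-- A compact convex set of vectors, none of which lies below `c`, is strictly separated from
`c` by a nonnegative weight vector. -/
theorem exists_nonneg_weights_of_forall_not_le {ι : Type*} [Fintype ι] {K : Set (ι → ℝ)}
    (hconv : Convex ℝ K) (hcomp : IsCompact K) {c : ι → ℝ} (hK : ∀ v ∈ K, ¬ v ≤ c) :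
    ∃ h : ι → ℝ, (∀ i, 0 ≤ h i) ∧ ∀ v ∈ K, ∑ i, h i * c i < ∑ i, h i * v i := by
  classical
  have hdisj : Disjoint (Set.Iic c) K :=
    Set.disjoint_left.2 fun v hv hvK => hK v hvK hv
  obtain ⟨f, a, b, hfa, hab, hfb⟩ :=
    geometric_hahn_banach_closed_compact (convex_Iic c) isClosed_Iic hconv hcomp hdisj
  have hf : ∀ v : ι → ℝ, f v = ∑ i, f (Pi.single i 1) * v i := fun v => by
    conv_lhs => rw [pi_eq_sum_univ' v]
    simp only [map_sum, map_smul, smul_eq_mul]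
    refine Finset.sum_congr rfl fun i _ => ?_
    rw [mul_comm]
  refine ⟨fun i => f (Pi.single i 1), fun i => ?_, fun v hv => ?_⟩
  · by_contra! hneg
    have hc : f c < a := hfa c Set.self_mem_Iic
    set t : ℝ := (a - f c) / -f (Pi.single i 1)
    have ht0 : 0 ≤ t := div_nonneg (by linarith) (by linarith)
    have hmem : c - t • Pi.single i (1 : ℝ) ∈ Set.Iic c :=
      sub_le_self c (smul_nonneg ht0 (Pi.single_nonneg.2 zero_le_one))
    have hlt := hfa _ hmem
    have hmul : t * -f (Pi.single i 1) = a - f c := div_mul_cancel₀ _ (by linarith)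
    rw [map_sub, map_smul, smul_eq_mul] at hlt
    linarith
  · rw [← hf, ← hf]
    exact (hfa c Set.self_mem_Iic).trans (hab.trans (hfb v hv))

/-- The payoff vector of the product of `x` with a fixed `y`, as a linear map in `x`. -/
def payoffMap {m n k : ℕ} (u : Fin k → Fin m × Fin n → ℝ) (y : Fin n → ℝ) :
    (Fin m → ℝ) →ₗ[ℝ] (Fin k → ℝ) where
  toFun x i := lin (u i) (prodCSP x y)
  map_add' x x' := by
    ext i
    simp [lin, prodCSP, add_mul, Finset.sum_add_distrib]
  map_smul' r x := by
    ext i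
    simp [lin, prodCSP, mul_assoc, Finset.mul_sum]

/-- Products of mixed strategies are CSPs. -/
theorem prodCSP_mem_stdSimplex {m n : ℕ} {x : Fin m → ℝ} {y : Fin n → ℝ}
    (hx : x ∈ stdSimplex ℝ (Fin m)) (hy : y ∈ stdSimplex ℝ (Fin n)) :
    prodCSP x y ∈ stdSimplex ℝ (Fin m × Fin n) := by
  refine ⟨fun p => mul_nonneg (hx.1 _) (hy.1 _), ?_⟩
  simp only [prodCSP, Fintype.sum_prod_type]
  rw [← Finset.sum_mul_sum, hx.2, hy.2, one_mul]

/-- if `x ⊗ y* ∉ C(Φ)` for every `x ∈ Δ_m`, then there is a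
nonnegative `h ∈ ℝ^k` such that every CSP assignment `Φ'` whose candidate
menu `C(Φ')` is response-satisfiable satisfies
`Σ_i h_i u_{O,i}(φ'_i) > Σ_i h_i u_{O,i}(φ_i)`: the hyperplane separates `Φ`
from the valid candidate set `S`. -/
theorem separating_hyperplane_from_S {m n k : ℕ}
    (hm : 0 < m) (hn : 0 < n) (hk : 0 < k)
    (uO : Fin k → Fin m × Fin n → ℝ)
    (Φ : Fin k → Fin m × Fin n → ℝ)
    (hΦ : ∀ i, Φ i ∈ stdSimplex ℝ (Fin m × Fin n))
    (ystar : Fin n → ℝ) (hy : ystar ∈ stdSimplex ℝ (Fin n))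
    (hmiss : ∀ x ∈ stdSimplex ℝ (Fin m), prodCSP x ystar ∉ candidateMenu uO Φ) :
    ∃ h : Fin k → ℝ, (∀ i, 0 ≤ h i) ∧
      ∀ Φ' : Fin k → Fin m × Fin n → ℝ,
        (∀ i, Φ' i ∈ stdSimplex ℝ (Fin m × Fin n)) →
        ResponseSatisfiable (candidateMenu uO Φ') →
        ∑ i, h i * lin (uO i) (Φ i) < ∑ i, h i * lin (uO i) (Φ' i) := by
  obtain ⟨h, h_nonneg, h_sep⟩ := exists_nonneg_weights_of_forall_not_le
    (K := payoffMap uO ystar '' stdSimplex ℝ (Fin m)) (c := fun i => lin (uO i) (Φ i))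
    ((convex_stdSimplex ℝ (Fin m)).linear_image _)
    ((isCompact_stdSimplex ℝ (Fin m)).image (payoffMap uO ystar).continuous_of_finiteDimensional)
    (by
      rintro _ ⟨x, hx, rfl⟩ hle
      exact hmiss x hx ⟨prodCSP_mem_stdSimplex hx hy, hle⟩)
  refine ⟨h, h_nonneg, fun Φ' _ hresp => ?_⟩
  obtain ⟨x, hx, -, hle⟩ := hresp ystar hy
  exact (h_sep _ ⟨x, hx, rfl⟩).trans_le
    (Finset.sum_le_sum fun i _ => mul_le_mul_of_nonneg_left (hle i) (h_nonneg i))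
end
end

section
/- (If V is at most the maximin value of some valid menu, the level-V candidate menu is response-satisfiable.) Fix a learner payoff u_L and V ∈ ℝ, and let F(V) = {φ ∈ Δ_{mn} : u_L(φ) ≥ V}. Suppose there exist a closed convex response-satisfiable set M ⊆ Δ_{mn} and points ψ_1,…,ψ_k ∈ M such that for each i ∈ [k], u_{O,i}(ψ_i) = sup_{φ∈M} u_{O,i}(φ) and u_L(ψ_i) ≥ V. Let φ_i ∈ F(V) satisfy u_{O,i}(φ_i) = sup_{φ∈F(V)} u_{O,i}(φ) for each i ∈ [k], and set Φ(V) = (φ_1,…,φ_k). Then C(Φ(V)) is response-satisfiable. -/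
open scoped BigOperators

noncomputable section

/-- The level set `F(V) = {φ ∈ Δ_{mn} : u_L(φ) ≥ V}`. -/
def levelSet {m n : ℕ} (uL : Fin m × Fin n → ℝ) (V : ℝ) :
    Set (Fin m × Fin n → ℝ) :=
  {φ ∈ stdSimplex ℝ (Fin m × Fin n) | V ≤ lin uL φ}

/-- A payoff function is bounded above on every set of CSPs. -/
theorem bddAbove_lin_image {m n : ℕ} (u : Fin m × Fin n → ℝ) {S : Set (Fin m × Fin n → ℝ)}
    (hS : S ⊆ stdSimplex ℝ (Fin m × Fin n)) : BddAbove (lin u '' S) := by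
  have hcont : Continuous (lin u) := by
    unfold lin
    fun_prop
  exact ((isCompact_stdSimplex ℝ (Fin m × Fin n)).bddAbove_image hcont.continuousOn).mono
    (Set.image_mono hS)

/-- if `V` is at most the maximin value of some valid menu `M`
(with optimizer-optimal points `ψ_i ∈ M` of learner value at least `V`), and
`Φ(V)` assigns each type its `u_{O,i}`-optimal CSP in `F(V)`, then the level-V
candidate menu `C(Φ(V))` is response-satisfiable. -/
theorem level_candidate_menu_response_satisfiable {m n k : ℕ}
    (hm : 0 < m) (hn : 0 < n) (hk : 0 < k)
    (uL : Fin m × Fin n → ℝ) (uO : Fin k → Fin m × Fin n → ℝ) (V : ℝ)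
    (M : Set (Fin m × Fin n → ℝ))
    (hMcl : IsClosed M) (hMcv : Convex ℝ M)
    (hMsub : M ⊆ stdSimplex ℝ (Fin m × Fin n))
    (hMrs : ResponseSatisfiable M)
    (ψ : Fin k → Fin m × Fin n → ℝ)
    (hψM : ∀ i, ψ i ∈ M)
    (hψmax : ∀ i, lin (uO i) (ψ i) = sSup (lin (uO i) '' M))
    (hψV : ∀ i, V ≤ lin uL (ψ i))
    (Φ : Fin k → Fin m × Fin n → ℝ)
    (hΦF : ∀ i, Φ i ∈ levelSet uL V)
    (hΦmax : ∀ i, lin (uO i) (Φ i) = sSup (lin (uO i) '' levelSet uL V)) :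
    ResponseSatisfiable (candidateMenu uO Φ) := by
  intro y hy
  obtain ⟨x, hx, hxM⟩ := hMrs y hy
  refine ⟨x, hx, hMsub hxM, fun i => ?_⟩
  calc lin (uO i) (prodCSP x y)
      ≤ sSup (lin (uO i) '' M) :=
        le_csSup (bddAbove_lin_image (uO i) hMsub) (Set.mem_image_of_mem _ hxM)
    _ = lin (uO i) (ψ i) := (hψmax i).symm
    _ ≤ sSup (lin (uO i) '' levelSet uL V) :=
        le_csSup (bddAbove_lin_image (uO i) (Set.sep_subset _ _))
          (Set.mem_image_of_mem _ ⟨hMsub (hψM i), hψV i⟩)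
    _ = lin (uO i) (Φ i) := (hΦmax i).symm
end
end
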